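/- Small-threshold expansion of the truncated χ²₁ mean (proved in Theorem 6's proof, where ν*_{1,β} is evaluated): letting γ = gaussianReal 0 1 be the standard Gaussian measure on ℝ, there exist constants C > 0 and ε > 0 such that for all real a with 0 < a < ε, |∫ x^2 d(γ[| {x : x^2 < a}]) − a/3| ≤ C * a^2. In words: for Z standard normal, E[Z² | Z² < a] = a/3 + O(a²) as a → 0⁺. -/

import Mathlib

open MeasureTheory ProbabilityTheory

/-- The conditional expectation of `f` under a standard Gaussian restricted to `(-r, r)`, as a
quotient of interval integrals against the unnormalized density. -/
lemma integral_cond_gaussianReal_Ioo {r : ℝ} (hr : 0 ≤ r) (f : ℝ → ℝ) :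
    ∫ x, f x ∂((gaussianReal 0 1)[|Set.Ioo (-r) r]) =
      (∫ x in (-r)..r, Real.exp (-x ^ 2 / 2))⁻¹ *
        ∫ x in (-r)..r, Real.exp (-x ^ 2 / 2) * f x := by
  have h (g : ℝ → ℝ) : ∫ x in Set.Ioo (-r) r, g x ∂(gaussianReal 0 1) =
      (√(2 * Real.pi))⁻¹ * ∫ x in (-r)..r, Real.exp (-x ^ 2 / 2) * g x := by
    rw [gaussianReal_of_var_ne_zero _ one_ne_zero,
      setIntegral_withDensity_eq_setIntegral_toReal_smul (measurable_gaussianPDF _ _)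
        (ae_of_all _ fun _ ↦ gaussianPDF_lt_top) _ measurableSet_Ioo,
      intervalIntegral.integral_of_le (by linarith), integral_Ioc_eq_integral_Ioo,
      ← integral_const_mul]
    simp [gaussianPDFReal, mul_assoc]
  have hD : (gaussianReal 0 1).real (Set.Ioo (-r) r) =
      (√(2 * Real.pi))⁻¹ * ∫ x in (-r)..r, Real.exp (-x ^ 2 / 2) := by
    simpa using h fun _ ↦ 1
  have hc : √(2 * Real.pi) ≠ 0 := by positivity
  rw [ProbabilityTheory.cond, integral_smul_measure, h, ENNReal.toReal_inv, ← measureReal_def, hD,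
    smul_eq_mul, mul_inv, inv_inv]
  field_simp

lemma abs_exp_neg_sq_div_two_sub_one_le (x : ℝ) :
    |Real.exp (-x ^ 2 / 2) - 1| ≤ x ^ 2 / 2 := by
  have h₁ : Real.exp (-x ^ 2 / 2) ≤ 1 := Real.exp_le_one_iff.2 (by nlinarith [sq_nonneg x])
  have h₂ := Real.add_one_le_exp (-x ^ 2 / 2)
  rw [abs_le]
  constructor <;> linarith [sq_nonneg x]

lemma abs_integral_exp_mul_sq_sub_le {r : ℝ} (hr : 0 ≤ r) :
    |∫ x in (-r)..r, Real.exp (-x ^ 2 / 2) * (x ^ 2 - r ^ 2 / 3)| ≤ r ^ 5 := by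
  have h₀ : ∫ x in (-r)..r, (x ^ 2 - r ^ 2 / 3) = 0 := by
    rw [intervalIntegral.integral_sub (by simp) (by simp)]
    simp
    ring
  have h : ∫ x in (-r)..r, Real.exp (-x ^ 2 / 2) * (x ^ 2 - r ^ 2 / 3) =
      ∫ x in (-r)..r, (Real.exp (-x ^ 2 / 2) - 1) * (x ^ 2 - r ^ 2 / 3) := by
    simp_rw [sub_mul (Real.exp _), one_mul]
    rw [intervalIntegral.integral_sub (Continuous.intervalIntegrable (by fun_prop) _ _)
      (Continuous.intervalIntegrable (by fun_prop) _ _), h₀, sub_zero]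
  have hb : ∀ x ∈ Set.uIoc (-r) r,
      ‖(Real.exp (-x ^ 2 / 2) - 1) * (x ^ 2 - r ^ 2 / 3)‖ ≤ r ^ 2 / 2 * r ^ 2 := by
    intro x hx
    rw [Set.uIoc_of_le (by linarith)] at hx
    have hx₂ : x ^ 2 ≤ r ^ 2 := sq_le_sq' hx.1.le hx.2
    rw [norm_mul]
    gcongr
    · exact (abs_exp_neg_sq_div_two_sub_one_le x).trans (by linarith)
    · rw [Real.norm_eq_abs, abs_le]
      constructor <;> nlinarith [sq_nonneg x]
  rw [h, ← Real.norm_eq_abs]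
  refine (intervalIntegral.norm_integral_le_of_norm_le_const hb).trans_eq ?_
  rw [abs_of_nonneg (by linarith)]
  ring

lemma le_integral_exp_neg_sq_div_two {r : ℝ} (hr : 0 ≤ r) (hr₁ : r ≤ 1) :
    r ≤ ∫ x in (-r)..r, Real.exp (-x ^ 2 / 2) := by
  calc r = ∫ _ in (-r)..r, (1 / 2 : ℝ) := by simp; ring
    _ ≤ _ := intervalIntegral.integral_mono_on (by linarith) (by simp)
      (Continuous.intervalIntegrable (by fun_prop) _ _) fun x hx ↦ by
        have := Real.add_one_le_exp (-x ^ 2 / 2)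
        nlinarith [hx.1, hx.2]

/-- Small-threshold expansion of the truncated χ²₁ mean: for `Z` standard normal,
`E[Z² | Z² < a] = a/3 + O(a²)` as `a → 0⁺`. -/
theorem truncated_chi_square_mean_expansion :
    ∃ C > (0 : ℝ), ∃ ε > (0 : ℝ), ∀ a : ℝ, 0 < a → a < ε →
      |(∫ x, x ^ 2 ∂((gaussianReal 0 1)[|{x : ℝ | x ^ 2 < a}])) - a / 3| ≤ C * a ^ 2 := by
  refine ⟨1, one_pos, 1, one_pos, fun a ha ha₁ ↦ ?_⟩
  obtain ⟨r, hr, rfl⟩ : ∃ r : ℝ, 0 < r ∧ r ^ 2 = a := ⟨√a, by positivity, Real.sq_sqrt ha.le⟩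
  have hs : {x : ℝ | x ^ 2 < r ^ 2} = Set.Ioo (-r) r := by
    ext x
    simp [sq_lt_sq, abs_of_pos hr, abs_lt]
  have hD := le_integral_exp_neg_sq_div_two hr.le (by nlinarith)
  have hN := abs_integral_exp_mul_sq_sub_le hr.le
  simp_rw [mul_sub] at hN
  rw [intervalIntegral.integral_sub (Continuous.intervalIntegrable (by fun_prop) _ _)
    (Continuous.intervalIntegrable (by fun_prop) _ _), intervalIntegral.integral_mul_const] at hN
  rw [hs, integral_cond_gaussianReal_Ioo hr.le]
  set D := ∫ x in (-r)..r, Real.exp (-x ^ 2 / 2)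
  set N := ∫ x in (-r)..r, Real.exp (-x ^ 2 / 2) * x ^ 2
  have hD₀ : 0 < D := hr.trans_le hD
  have h : D⁻¹ * N - r ^ 2 / 3 = (N - D * (r ^ 2 / 3)) / D := by field_simp
  rw [h, abs_div, abs_of_pos hD₀, div_le_iff₀ hD₀]
  calc _ ≤ r ^ 5 := hN
    _ = 1 * (r ^ 2) ^ 2 * r := by ring
    _ ≤ _ := by gcongr
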